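/- arXiv:2309.11189 — 3 statements merged into one kernel-verified Lean document; each statement's English description precedes it below -/
import Mathlib

section
/- In a marginal price auction with N bidders and K tickets, N > K, truthful bidding weakly dominates every other bid: for every bidder i with valuation v_i, every fixed profile of the other N−1 bidders' bids, and every alternative bid β, the payoff bidder i receives when submitting the bid v_i is greater than or equal to the payoff bidder i receives when submitting the bid β (with the final price recomputed for each bid profile). -/
/-- The `K`-th highest entry (1-indexed) of a list of real bids:
the `K`-th entry of the list sorted in descending order. -/
noncomputable def kthHighest (l : List ℝ) (K : ℕ) : ℝ :=
  (l.insertionSort (· ≥ ·)).getD (K - 1) 0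

/-- The final price in a marginal price auction with `K` tickets and bid
profile `c`: the `K`-th highest of the submitted bids (the lowest winning bid). -/
noncomputable def finalPrice {N : ℕ} (K : ℕ) (c : Fin N → ℝ) : ℝ :=
  kthHighest (List.ofFn c) K

/-- The payoff of bidder `i` with valuation `v` under bid profile `c`:
`v - p` if bidder `i` wins (i.e. `c i > p` where `p` is the final price),
and `0` otherwise. -/
noncomputable def payoff {N : ℕ} (K : ℕ) (v : ℝ) (i : Fin N) (c : Fin N → ℝ) : ℝ :=
  if finalPrice K c < c i then v - finalPrice K c else 0

/-- In a descending list, the entry at index `k` is at least `x` exactly when more than `k`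
entries are at least `x`. -/
theorem le_getElem_iff_lt_countP_of_pairwise_ge {l : List ℝ} (hl : l.Pairwise (· ≥ ·))
    {k : ℕ} (hk : k < l.length) (x : ℝ) :
    x ≤ l[k] ↔ k < l.countP (fun a => decide (x ≤ a)) := by
  induction l generalizing k with
  | nil => simp at hk
  | cons a t ih =>
    rw [List.pairwise_cons] at hl
    by_cases hxa : x ≤ a
    · cases k with
      | zero => simp [hxa]
      | succ k =>
        have hkt : k < t.length := by simpa using hk
        simpa [hxa] using ih hl.2 hkt
    · have hlt : ∀ y ∈ a :: t, y < x := by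
        intro y hy
        rcases List.mem_cons.1 hy with rfl | hy
        · exact not_le.1 hxa
        · exact (hl.1 y hy).trans_lt (not_le.1 hxa)
      have hcount : (a :: t).countP (fun a => decide (x ≤ a)) = 0 :=
        List.countP_eq_zero.2 fun y hy => by simpa using hlt y hy
      rw [hcount]
      simpa using hlt _ (List.getElem_mem hk)

theorem le_kthHighest_iff {l : List ℝ} {K : ℕ} (hK : 0 < K) (hKl : K ≤ l.length) (x : ℝ) :
    x ≤ kthHighest l K ↔ K ≤ l.countP (fun a => decide (x ≤ a)) := by
  have hk : K - 1 < (l.insertionSort (· ≥ ·)).length := by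
    rw [List.length_insertionSort]; omega
  rw [kthHighest, List.getD_eq_getElem _ _ hk,
    le_getElem_iff_lt_countP_of_pairwise_ge (List.pairwise_insertionSort _ l) hk,
    (List.perm_insertionSort (· ≥ ·) l).countP_eq]
  omega

/-- Whether the final price reaches a level `x` does not depend on which bid of at least `x`
bidder `i` submits. -/
theorem le_finalPrice_update_iff {N K : ℕ} (hK : 0 < K) (hKN : K ≤ N) (i : Fin N)
    (b : Fin N → ℝ) {x y z : ℝ} (hy : x ≤ y) (hz : x ≤ z) :
    x ≤ finalPrice K (Function.update b i y) ↔ x ≤ finalPrice K (Function.update b i z) := by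
  have hcomp : (fun a => decide (x ≤ a)) ∘ Function.update b i y =
      (fun a => decide (x ≤ a)) ∘ Function.update b i z := by
    funext j
    by_cases hj : j = i
    · subst hj; simp [hy, hz]
    · simp [hj]
  rw [finalPrice, finalPrice, le_kthHighest_iff hK (by simpa using hKN),
    le_kthHighest_iff hK (by simpa using hKN), List.ofFn_eq_map, List.ofFn_eq_map,
    List.countP_map, List.countP_map, hcomp]

/-- Changing a winning bid to another bid above the final price leaves the price unchanged. -/
theorem finalPrice_update_eq_of_lt {N K : ℕ} (hK : 0 < K) (hKN : K ≤ N) (i : Fin N)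
    (b : Fin N → ℝ) {y z : ℝ} (hy : finalPrice K (Function.update b i y) < y)
    (hz : finalPrice K (Function.update b i y) < z) :
    finalPrice K (Function.update b i z) = finalPrice K (Function.update b i y) := by
  refine le_antisymm (not_lt.1 fun h => ?_)
    ((le_finalPrice_update_iff hK hKN i b hy.le hz.le).1 le_rfl)
  have hmin : finalPrice K (Function.update b i y) <
      min (finalPrice K (Function.update b i z)) (min y z) := lt_min h (lt_min hy hz)
  exact hmin.not_ge <| (le_finalPrice_update_iff hK hKN i b
    ((min_le_right _ _).trans (min_le_left _ _))
    ((min_le_right _ _).trans (min_le_right _ _))).2 (min_le_left _ _)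

theorem payoff_update_self_nonneg {N : ℕ} (K : ℕ) (v : ℝ) (i : Fin N) (b : Fin N → ℝ) :
    0 ≤ payoff K v i (Function.update b i v) := by
  rw [payoff, Function.update_self]
  split_ifs with h
  · exact sub_nonneg.2 h.le
  · exact le_rfl

/-- In a marginal price auction with `N` bidders and `K` tickets, `N > K`,
truthful bidding weakly dominates every other bid: for every bidder `i` with
valuation `v`, every fixed profile `b` of the other bidders' bids, and every
alternative bid `β`, the payoff from bidding `v` is at least the payoff from
bidding `β`. -/
theorem truthful_bidding_weakly_dominates {N K : ℕ} (hK : 0 < K) (hKN : K < N)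
    (i : Fin N) (v : ℝ) (b : Fin N → ℝ) (β : ℝ) :
    payoff K v i (Function.update b i β) ≤ payoff K v i (Function.update b i v) := by
  have hnonneg := payoff_update_self_nonneg K v i b
  by_cases hβ : finalPrice K (Function.update b i β) < β
  · by_cases hv : finalPrice K (Function.update b i β) < v
    · have hprice := finalPrice_update_eq_of_lt hK hKN.le i b hβ hv
      simp [payoff, hprice, hβ, hv]
    · refine le_trans ?_ hnonneg
      simpa [payoff, hβ] using hv
  · simpa [payoff, hβ] using hnonneg
end

section
/- In a marginal price auction with N bidders and K tickets, N > K, overbidding is weakly dominated by truthful bidding: for every bidder i with valuation v_i, every fixed profile of the other N−1 bidders' bids, and every bid β with β > v_i, the payoff bidder i receives when submitting the bid β is less than or equal to the payoff bidder i receives when submitting the bid v_i (with the final price recomputed for each bid profile). -/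
namespace List

variable {α : Type*} [LinearOrder α]

theorem orderedInsert_ge_eq_cons {a : α} {l : List α} (h : (a :: l).Pairwise (· ≥ ·)) :
    l.orderedInsert (· ≥ ·) a = a :: l := by
  cases l with
  | nil => rfl
  | cons b l => exact orderedInsert_cons_of_le _ _ (rel_of_pairwise_cons h mem_cons_self)

theorem Forall₂.orderedInsert_ge {l l' : List α} (h : Forall₂ (· ≤ ·) l l') :
    ∀ {a a' : α}, l.Pairwise (· ≥ ·) → l'.Pairwise (· ≥ ·) → a ≤ a' →
      Forall₂ (· ≤ ·) (l.orderedInsert (· ≥ ·) a) (l'.orderedInsert (· ≥ ·) a') := by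
  induction h with
  | nil => intro a a' _ _ ha; exact .cons ha .nil
  | @cons b b' l l' hb hl ih =>
    intro a a' hs hs' ha
    rcases le_or_gt b a with h | h <;> rcases le_or_gt b' a' with h' | h'
    · rw [orderedInsert_cons_of_le (· ≥ ·) l h, orderedInsert_cons_of_le (· ≥ ·) l' h']
      exact .cons ha (.cons hb hl)
    · rw [orderedInsert_cons_of_le (· ≥ ·) l h,
        orderedInsert_of_not_le (r := (· ≥ ·)) l' h'.not_ge, ← orderedInsert_ge_eq_cons hs]
      exact .cons (ha.trans h'.le) (ih hs.of_cons hs'.of_cons (h.trans ha))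
    · rw [orderedInsert_of_not_le (r := (· ≥ ·)) l h.not_ge,
        orderedInsert_cons_of_le (· ≥ ·) l' h', ← orderedInsert_ge_eq_cons hs']
      exact .cons (hb.trans h') (ih hs.of_cons hs'.of_cons (h.le.trans hb))
    · rw [orderedInsert_of_not_le (r := (· ≥ ·)) l h.not_ge,
        orderedInsert_of_not_le (r := (· ≥ ·)) l' h'.not_ge]
      exact .cons hb (ih hs.of_cons hs'.of_cons ha)

theorem Forall₂.insertionSort_ge {l l' : List α} (h : Forall₂ (· ≤ ·) l l') :
    Forall₂ (· ≤ ·) (l.insertionSort (· ≥ ·)) (l'.insertionSort (· ≥ ·)) := by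
  induction h with
  | nil => exact .nil
  | cons ha _ ih =>
    exact ih.orderedInsert_ge (pairwise_insertionSort _ _) (pairwise_insertionSort _ _) ha

theorem Forall₂.getD_le {l l' : List α} (h : Forall₂ (· ≤ ·) l l') (d : α) :
    ∀ n, l.getD n d ≤ l'.getD n d := by
  induction h with
  | nil => intro n; exact le_rfl
  | cons ha _ ih =>
    intro n
    cases n with
    | zero => simpa using ha
    | succ n => simpa using ih n

end List

theorem finalPrice_mono {N : ℕ} (K : ℕ) : Monotone (finalPrice (N := N) K) := by
  intro c c' h
  refine List.Forall₂.getD_le (List.Forall₂.insertionSort_ge ?_) 0 _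
  exact List.forall₂_iff_get.2 ⟨by simp, fun j _ _ => by simpa using h _⟩

/-- Overbidding is weakly dominated by truthful bidding: for every bidder `i`
with valuation `v`, every fixed profile `b` of the other bidders' bids, and
every bid `β > v`, the payoff from bidding `β` is at most the payoff from
bidding `v`. -/
theorem overbidding_weakly_dominated {N K : ℕ} (hK : 0 < K) (hKN : K < N)
    (i : Fin N) (v : ℝ) (b : Fin N → ℝ) (β : ℝ) (hβ : v < β) :
    payoff K v i (Function.update b i β) ≤ payoff K v i (Function.update b i v) := by
  have hp : finalPrice K (Function.update b i v) ≤ finalPrice K (Function.update b i β) :=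
    finalPrice_mono K (Function.update_mono hβ.le)
  simp only [payoff, Function.update_self]
  split_ifs <;> linarith
end

section
/- In a marginal price auction with N bidders and K tickets, N > K, underbidding is weakly dominated by truthful bidding: for every bidder i with valuation v_i, every fixed profile of the other N−1 bidders' bids, and every bid β with β < v_i, the payoff bidder i receives when submitting the bid β is less than or equal to the payoff bidder i receives when submitting the bid v_i (with the final price recomputed for each bid profile). -/
theorem List.le_getElem_iff_lt_countP {α : Type*} [LinearOrder α] (x : α) {l : List α}
    (hl : l.Pairwise (· ≥ ·)) {k : ℕ} (hk : k < l.length) :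
    x ≤ l[k] ↔ k < l.countP (fun y => decide (x ≤ y)) := by
  induction l generalizing k with
  | nil => simp at hk
  | cons a t ih =>
    obtain ⟨ha, ht⟩ := List.pairwise_cons.mp hl
    by_cases hxa : x ≤ a
    · cases k with
      | zero => simp [hxa]
      | succ k => simpa [hxa] using ih ht (by simpa using hk)
    · have hmem : ∀ y ∈ a :: t, ¬ x ≤ y := by
        intro y hy hxy
        rcases List.mem_cons.mp hy with rfl | hy
        · exact hxa hxy
        · exact hxa (hxy.trans (ha y hy))
      have hcount : (a :: t).countP (fun y => decide (x ≤ y)) = 0 :=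
        List.countP_eq_zero.mpr fun y hy => by simpa using hmem y hy
      simpa [hcount] using hmem _ (List.getElem_mem hk)

theorem le_finalPrice_iff {N K : ℕ} (hK : 0 < K) (hKN : K ≤ N) (c : Fin N → ℝ) (x : ℝ) :
    x ≤ finalPrice K c ↔ K ≤ (List.ofFn fun j => decide (x ≤ c j)).count true := by
  have hk : K - 1 < ((List.ofFn c).insertionSort (· ≥ ·)).length := by
    rw [List.length_insertionSort, List.length_ofFn]
    omega
  rw [finalPrice, kthHighest, List.getD_eq_getElem _ _ hk,
    List.le_getElem_iff_lt_countP x (List.pairwise_insertionSort _ _) hk,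
    (List.perm_insertionSort _ _).countP_eq]
  have hcount : (List.ofFn c).countP (fun y => decide (x ≤ y)) =
      (List.ofFn fun j => decide (x ≤ c j)).count true := by
    rw [← Function.comp_def (fun y => decide (x ≤ y)) c, ← List.map_ofFn, List.count,
      List.countP_map]
    congr 1
    ext y
    simp
  rw [hcount]
  omega

/-- Raising a winning bid does not raise the final price. -/
theorem finalPrice_update_le_of_lt {N K : ℕ} (hK : 0 < K) (hKN : K ≤ N) (i : Fin N)
    (b : Fin N → ℝ) {β v : ℝ} (hβ : β ≤ v) (hwin : finalPrice K (Function.update b i β) < β) :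
    finalPrice K (Function.update b i v) ≤ finalPrice K (Function.update b i β) := by
  by_contra! hlt
  set x := min (finalPrice K (Function.update b i v)) β
  have hxβ : x ≤ β := min_le_right _ _
  have hsame : (fun j => decide (x ≤ Function.update b i v j)) =
      fun j => decide (x ≤ Function.update b i β j) := by
    funext j
    rcases eq_or_ne j i with rfl | hj
    · simp [hxβ, hxβ.trans hβ]
    · simp [hj]
  have hle : x ≤ finalPrice K (Function.update b i v) := min_le_left _ _
  rw [le_finalPrice_iff hK hKN, hsame, ← le_finalPrice_iff hK hKN] at hle
  exact (lt_min hlt hwin).not_ge hle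

/-- Underbidding is weakly dominated by truthful bidding: for every bidder `i`
with valuation `v`, every fixed profile `b` of the other bidders' bids, and
every bid `β < v`, the payoff from bidding `β` is at most the payoff from
bidding `v`. -/
theorem underbidding_weakly_dominated {N K : ℕ} (hK : 0 < K) (hKN : K < N)
    (i : Fin N) (v : ℝ) (b : Fin N → ℝ) (β : ℝ) (hβ : β < v) :
    payoff K v i (Function.update b i β) ≤ payoff K v i (Function.update b i v) := by
  by_cases hwin : finalPrice K (Function.update b i β) < β
  · have hle := finalPrice_update_le_of_lt hK hKN.le i b hβ.le hwin
    have hwin' : finalPrice K (Function.update b i v) < v := hle.trans_lt (hwin.trans hβ)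
    simp only [payoff, Function.update_self, if_pos hwin, if_pos hwin']
    exact sub_le_sub_left hle v
  · simp only [payoff, Function.update_self, if_neg hwin]
    split_ifs with h
    · exact (sub_pos.mpr h).le
    · exact le_rfl
end
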